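/- arXiv:1503.06349 — 4 statements merged into one kernel-verified Lean document; each statement's English description precedes it below -/
import Mathlib

section
/- Let r > 0, C_W ≥ 0, 𝒥 ≥ 0 and m ∈ ℕ. Let γ and η be finite sets, σ : γ → ℝ^m and ξ : η → ℝ^m mark assignments, W : ℝ^m × ℝ^m → ℝ with |W(u,v)| ≤ |u|^r + |v|^r + C_W for all u, v ∈ ℝ^m, and (J_{xy}) real couplings with |J_{xy}| ≤ 𝒥. Then the conditional spin energy E := Σ_{{x,y}⊂γ} J_{xy} W(σ_x, σ_y) + Σ_{x∈γ} Σ_{y∈η} J_{xy} W(σ_x, ξ_y) satisfies |E| ≤ 𝒥 · [ (N(η) + 2·N(γ))·Σ_{x∈γ} |σ_x|^r + N(γ)·Σ_{y∈η} |ξ_y|^r + (N(γ)² + N(γ)·N(η))·C_W ]. -/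
/-- Half of the off-diagonal double sum: the sum `Σ_{{x,y}⊂γ}` over unordered pairs of
distinct elements of `γ` of a symmetric summand. -/
noncomputable def pairEnergy {α : Type*} (Φ : α → α → ℝ) (γ : Finset α) : ℝ :=
  ((∑ x ∈ γ, ∑ y ∈ γ, Φ x y) - ∑ x ∈ γ, Φ x x) / 2

theorem abs_pairEnergy_le {α : Type*} (Φ : α → α → ℝ) (γ : Finset α) :
    |pairEnergy Φ γ| ≤ ∑ x ∈ γ, ∑ y ∈ γ, |Φ x y| := by
  have hfull : |∑ x ∈ γ, ∑ y ∈ γ, Φ x y| ≤ ∑ x ∈ γ, ∑ y ∈ γ, |Φ x y| :=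
    (Finset.abs_sum_le_sum_abs _ _).trans
      (Finset.sum_le_sum fun x _ => Finset.abs_sum_le_sum_abs _ _)
  have hdiag : |∑ x ∈ γ, Φ x x| ≤ ∑ x ∈ γ, ∑ y ∈ γ, |Φ x y| :=
    (Finset.abs_sum_le_sum_abs _ _).trans
      (Finset.sum_le_sum fun x hx =>
        Finset.single_le_sum (f := fun y => |Φ x y|) (fun y _ => abs_nonneg _) hx)
  rw [abs_le] at hfull hdiag
  unfold pairEnergy
  rw [abs_le]
  constructor <;> linarith [hfull.1, hfull.2, hdiag.1, hdiag.2]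

theorem sum_sum_abs_mul_le {α β : Type*} {K C : ℝ} (γ : Finset α) (η : Finset β)
    (J w : α → β → ℝ) (a : α → ℝ) (b : β → ℝ) (hK : 0 ≤ K)
    (hJ : ∀ x ∈ γ, ∀ y ∈ η, |J x y| ≤ K) (hw : ∀ x y, |w x y| ≤ a x + b y + C) :
    ∑ x ∈ γ, ∑ y ∈ η, |J x y * w x y| ≤
      K * ((η.card : ℝ) * ∑ x ∈ γ, a x + (γ.card : ℝ) * ∑ y ∈ η, b y
        + (γ.card : ℝ) * (η.card : ℝ) * C) := by
  calc ∑ x ∈ γ, ∑ y ∈ η, |J x y * w x y|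
      ≤ ∑ x ∈ γ, ∑ y ∈ η, K * (a x + b y + C) := by
        refine Finset.sum_le_sum fun x hx => Finset.sum_le_sum fun y hy => ?_
        rw [abs_mul]
        exact mul_le_mul (hJ x hx y hy) (hw x y) (abs_nonneg _) hK
    _ = _ := by
        simp only [← Finset.mul_sum, Finset.sum_add_distrib, Finset.sum_const, nsmul_eq_mul]
        ring

theorem conditional_spin_energy_volume_estimate {α β : Type*}
    (r CW 𝒥 : ℝ) (m : ℕ)
    (hr : 0 < r) (hCW : 0 ≤ CW) (h𝒥 : 0 ≤ 𝒥)
    (γ : Finset α) (η : Finset β)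
    (σ : α → EuclideanSpace ℝ (Fin m)) (ξ : β → EuclideanSpace ℝ (Fin m))
    (W : EuclideanSpace ℝ (Fin m) → EuclideanSpace ℝ (Fin m) → ℝ)
    (hW : ∀ u v, |W u v| ≤ ‖u‖ ^ r + ‖v‖ ^ r + CW)
    (Jin : α → α → ℝ) (Jout : α → β → ℝ)
    (hJin : ∀ x ∈ γ, ∀ y ∈ γ, |Jin x y| ≤ 𝒥)
    (hJout : ∀ x ∈ γ, ∀ y ∈ η, |Jout x y| ≤ 𝒥) :
    |pairEnergy (fun x y => Jin x y * W (σ x) (σ y)) γ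
        + ∑ x ∈ γ, ∑ y ∈ η, Jout x y * W (σ x) (ξ y)| ≤
      𝒥 * (((η.card : ℝ) + 2 * (γ.card : ℝ)) * ∑ x ∈ γ, ‖σ x‖ ^ r
          + (γ.card : ℝ) * ∑ y ∈ η, ‖ξ y‖ ^ r
          + ((γ.card : ℝ) ^ 2 + (γ.card : ℝ) * (η.card : ℝ)) * CW) := by
  have hin := (abs_pairEnergy_le (fun x y => Jin x y * W (σ x) (σ y)) γ).trans
    (sum_sum_abs_mul_le γ γ Jin (fun x y => W (σ x) (σ y)) (fun x => ‖σ x‖ ^ r)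
      (fun y => ‖σ y‖ ^ r) h𝒥 hJin fun x y => hW (σ x) (σ y))
  have hout : |∑ x ∈ γ, ∑ y ∈ η, Jout x y * W (σ x) (ξ y)| ≤ _ :=
    ((Finset.abs_sum_le_sum_abs _ _).trans
      (Finset.sum_le_sum fun x _ => Finset.abs_sum_le_sum_abs _ _)).trans
    (sum_sum_abs_mul_le γ η Jout (fun x y => W (σ x) (ξ y)) (fun x => ‖σ x‖ ^ r)
      (fun y => ‖ξ y‖ ^ r) h𝒥 hJout fun x y => hW (σ x) (ξ y))
  refine (abs_add_le _ _).trans ((add_le_add hin hout).trans_eq ?_)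
  ring
end

section
/- Let d ∈ ℕ, N₀ ∈ ℕ, θ > 0, C₀ ≥ 0, a > 0, D ≥ 0 and α > 0 with e^{αθ}·D·N₀ < 1. For every k ∈ ℤ^d let ∂k ⊂ ℤ^d be a finite set with card(∂k) ≤ N₀ and |j − k| ≤ θ for all j ∈ ∂k. Let K ⊂ ℤ^d be a finite nonempty set, let n : K → [0,∞) and F : ℤ^d → [0,∞), and assume that for every k ∈ K: n(k) ≤ C₀ + a·D·Σ_{j ∈ ∂k, j ∉ K} F(j) + D·Σ_{j ∈ ∂k, j ∈ K} n(j). Then for every k₀ ∈ K, n(k₀) ≤ (1 − e^{αθ}·D·N₀)^{−1} · ( C₀ + e^{αθ}·a·D·Σ_{j ∈ (⋃_{k∈K} ∂k) ∖ K} e^{−α|j−k₀|} F(j) ); indeed the same bound holds for sup_{k∈K} n(k)·e^{−α|k−k₀|}. -/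
/-- The Euclidean norm of a lattice point `k ∈ ℤ^d ⊂ ℝ^d`. -/
noncomputable def znorm {d : ℕ} (k : Fin d → ℤ) : ℝ :=
  Real.sqrt (∑ i, ((k i : ℝ)) ^ 2)

theorem znorm_eq_norm_toLp {d : ℕ} (k : Fin d → ℤ) :
    znorm k = ‖WithLp.toLp 2 (fun i => (k i : ℝ))‖ := by
  simp [znorm, EuclideanSpace.norm_eq]

theorem znorm_zero {d : ℕ} : znorm (0 : Fin d → ℤ) = 0 := by
  simp [znorm]

theorem znorm_nonneg {d : ℕ} (k : Fin d → ℤ) : 0 ≤ znorm k :=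
  Real.sqrt_nonneg _

theorem znorm_add_le {d : ℕ} (k l : Fin d → ℤ) : znorm (k + l) ≤ znorm k + znorm l := by
  simp only [znorm_eq_norm_toLp]
  refine le_of_eq_of_le ?_ (norm_add_le _ _)
  congr 1
  ext i
  simp

/-- A weighted supremum bound for a subsolution `n` of a linear recursion with finite neighbourhoods,
when the weight `w` changes by at most a factor `c` between neighbours. -/
theorem mul_weight_le_of_recursion {ι : Type*} [DecidableEq ι] {N : ℕ} {C A D c : ℝ}
    (hC : 0 ≤ C) (hA : 0 ≤ A) (hD : 0 ≤ D) (hc : 0 ≤ c) (hcontr : c * D * (N : ℝ) < 1)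
    {nb : ι → Finset ι} (hcard : ∀ k, (nb k).card ≤ N) {K : Finset ι} {n F w : ι → ℝ}
    (hn : ∀ k ∈ K, 0 ≤ n k) (hF : ∀ k, 0 ≤ F k) (hw₀ : ∀ k, 0 ≤ w k) (hw₁ : ∀ k, w k ≤ 1)
    (hw : ∀ k, ∀ j ∈ nb k, w k ≤ c * w j)
    (hrec : ∀ k ∈ K, n k ≤ C + A * (∑ j ∈ (nb k).filter (fun j => j ∉ K), F j)
      + D * (∑ j ∈ (nb k).filter (fun j => j ∈ K), n j)) :
    ∀ k ∈ K, n k * w k ≤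
      (1 - c * D * (N : ℝ))⁻¹ * (C + c * A * ∑ j ∈ K.biUnion nb \ K, w j * F j) := by
  intro k hk
  obtain ⟨m, hm, hmax⟩ := K.exists_max_image (fun k => n k * w k) ⟨k, hk⟩
  refine (hmax k hk).trans ?_
  rw [inv_mul_eq_div, le_div_iff₀ (by linarith)]
  have h_outer : w m * ∑ j ∈ (nb m).filter (fun j => j ∉ K), F j ≤
      c * ∑ j ∈ K.biUnion nb \ K, w j * F j := by
    rw [Finset.mul_sum, Finset.mul_sum]
    calc ∑ j ∈ (nb m).filter (fun j => j ∉ K), w m * F j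
        ≤ ∑ j ∈ (nb m).filter (fun j => j ∉ K), c * (w j * F j) := by
          refine Finset.sum_le_sum fun j hj => ?_
          rw [← mul_assoc]
          exact mul_le_mul_of_nonneg_right (hw m j (Finset.mem_filter.1 hj).1) (hF j)
      _ ≤ ∑ j ∈ K.biUnion nb \ K, c * (w j * F j) := by
          refine Finset.sum_le_sum_of_subset_of_nonneg (fun j hj => ?_)
            fun j _ _ => mul_nonneg hc (mul_nonneg (hw₀ j) (hF j))
          rw [Finset.mem_filter] at hj
          exact Finset.mem_sdiff.2 ⟨Finset.mem_biUnion.2 ⟨m, hm, hj.1⟩, hj.2⟩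
  have hM : 0 ≤ n m * w m := mul_nonneg (hn m hm) (hw₀ m)
  have h_inner : w m * ∑ j ∈ (nb m).filter (fun j => j ∈ K), n j ≤ N * (c * (n m * w m)) := by
    rw [Finset.mul_sum]
    calc ∑ j ∈ (nb m).filter (fun j => j ∈ K), w m * n j
        ≤ ∑ j ∈ (nb m).filter (fun j => j ∈ K), c * (n m * w m) := by
          refine Finset.sum_le_sum fun j hj => ?_
          rw [Finset.mem_filter] at hj
          calc w m * n j ≤ c * w j * n j :=
                mul_le_mul_of_nonneg_right (hw m j hj.1) (hn j hj.2)
            _ = c * (n j * w j) := by ring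
            _ ≤ c * (n m * w m) := mul_le_mul_of_nonneg_left (hmax j hj.2) hc
      _ ≤ N * (c * (n m * w m)) := by
          rw [Finset.sum_const, nsmul_eq_mul]
          refine mul_le_mul_of_nonneg_right ?_ (mul_nonneg hc hM)
          exact_mod_cast (Finset.card_filter_le _ _).trans (hcard m)
  have hCw : C * w m ≤ C := mul_le_of_le_one_right hC (hw₁ m)
  linarith [mul_le_mul_of_nonneg_right (hrec m hm) (hw₀ m),
    mul_le_mul_of_nonneg_left h_outer hA, mul_le_mul_of_nonneg_left h_inner hD]

theorem lattice_iteration_estimate {d : ℕ} (N₀ : ℕ) (θ C₀ a D α : ℝ)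
    (hθ : 0 < θ) (hC₀ : 0 ≤ C₀) (ha : 0 < a) (hD : 0 ≤ D) (hα : 0 < α)
    (hcontr : Real.exp (α * θ) * D * (N₀ : ℝ) < 1)
    (nb : (Fin d → ℤ) → Finset (Fin d → ℤ))
    (hnbcard : ∀ k, (nb k).card ≤ N₀)
    (hnbdist : ∀ k, ∀ j ∈ nb k, znorm (j - k) ≤ θ)
    (K : Finset (Fin d → ℤ)) (hK : K.Nonempty)
    (n F : (Fin d → ℤ) → ℝ)
    (hn : ∀ k ∈ K, 0 ≤ n k) (hF : ∀ k, 0 ≤ F k)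
    (hrec : ∀ k ∈ K,
      n k ≤ C₀ + a * D * (∑ j ∈ (nb k).filter (fun j => j ∉ K), F j)
        + D * (∑ j ∈ (nb k).filter (fun j => j ∈ K), n j)) :
    ∀ k₀ ∈ K,
      n k₀ ≤ (1 - Real.exp (α * θ) * D * (N₀ : ℝ))⁻¹ *
          (C₀ + Real.exp (α * θ) * a * D *
            ∑ j ∈ K.biUnion nb \ K, Real.exp (-α * znorm (j - k₀)) * F j) ∧
        ∀ k ∈ K,
          n k * Real.exp (-α * znorm (k - k₀)) ≤
            (1 - Real.exp (α * θ) * D * (N₀ : ℝ))⁻¹ *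
              (C₀ + Real.exp (α * θ) * a * D *
                ∑ j ∈ K.biUnion nb \ K, Real.exp (-α * znorm (j - k₀)) * F j) := by
  intro k₀ hk₀
  have hweight : ∀ k, ∀ j ∈ nb k, Real.exp (-α * znorm (k - k₀)) ≤
      Real.exp (α * θ) * Real.exp (-α * znorm (j - k₀)) := by
    intro k j hj
    rw [← Real.exp_add, Real.exp_le_exp]
    have htri : znorm (j - k₀) ≤ znorm (j - k) + znorm (k - k₀) := by
      simpa using znorm_add_le (j - k) (k - k₀)
    nlinarith [hnbdist k j hj]
  have hbound := mul_weight_le_of_recursion hC₀ (mul_nonneg ha.le hD) hD (Real.exp_pos _).le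
    hcontr hnbcard hn hF (fun k => (Real.exp_pos (-α * znorm (k - k₀))).le)
    (fun k => Real.exp_le_one_iff.2 (by nlinarith [znorm_nonneg (k - k₀)])) hweight hrec
  simp only [← mul_assoc (Real.exp (α * θ)) a D] at hbound
  exact ⟨by simpa [znorm_zero] using hbound k₀ hk₀, hbound⟩
end

section
/- Let I be a countable set and (E_i)_{i∈I} a family of Polish spaces; let Ω := Π_{i∈I} E_i carry the product σ-algebra of the Borel σ-algebras. For a finite set Λ ⊂ I let F_Λ denote the sub-σ-algebra of Ω generated by the coordinate projections (p_i)_{i∈Λ}, and let F₀ := ⋃_{Λ ⊂ I finite} F_Λ be the algebra of local (cylinder) sets. Let (μ_m)_{m∈ℕ} be a sequence of probability measures on Ω that is locally equicontinuous, i.e. for every finite Λ ⊂ I and every decreasing sequence (B_n)_{n∈ℕ} of sets in F_Λ with ⋂_n B_n = ∅ one has lim_{n→∞} limsup_{m→∞} μ_m(B_n) = 0. Then there exists a probability measure μ on Ω that is a cluster point of (μ_m) in the topology of local set convergence: for every ε > 0 and every finite collection B₁, …, B_N ∈ F₀, the set { m ∈ ℕ : |μ_m(B_j) − μ(B_j)|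 < ε for all 1 ≤ j ≤ N } is infinite. -/
open MeasureTheory Filter

/-- The sub-σ-algebra of the product space generated by the coordinate
projections with indices in the finite set `Λ`. -/
def localSigmaAlgebra {I : Type*} (E : I → Type*) [∀ i, MeasurableSpace (E i)]
    (Λ : Finset I) : MeasurableSpace (∀ i, E i) :=
  ⨆ i ∈ Λ, MeasurableSpace.comap (fun ω => ω i) inferInstance

open Set Topology ENNReal

/-- A pointwise limit of probability measures which is continuous at `∅` along a ring of measurable
sets generating the σ-algebra agrees on that ring with a measure. -/
lemma exists_measure_eq_of_tendsto {α β : Type*} [mα : MeasurableSpace α] {C : Set (Set α)}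
    (hC : IsSetRing C) (hgen : mα = MeasurableSpace.generateFrom C) {l : Filter β} [l.NeBot]
    {μs : β → Measure α} (hprob : ∀ m, IsProbabilityMeasure (μs m)) {c : Set α → ℝ≥0∞}
    (hc : ∀ s ∈ C, Tendsto (fun m => μs m s) l (𝓝 (c s)))
    (hc_zero : ∀ s : ℕ → Set α, (∀ n, s n ∈ C) → Antitone s → ⋂ n, s n = ∅ →
      Tendsto (fun n => c (s n)) atTop (𝓝 0)) :
    ∃ μ : Measure α, ∀ s ∈ C, μ s = c s := by
  have hmeas : ∀ s ∈ C, MeasurableSet s := fun s hs => by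
    rw [hgen]; exact MeasurableSpace.measurableSet_generateFrom hs
  let content : AddContent ℝ≥0∞ C := hC.addContent_of_union c
    (tendsto_nhds_unique (hc ∅ hC.empty_mem) (by simp))
    (fun {s t} hs ht hst => tendsto_nhds_unique (hc _ (hC.union_mem hs ht)) <| by
      simpa only [measure_union hst (hmeas t ht)] using (hc s hs).add (hc t ht))
  have hne_top : ∀ s ∈ C, content s ≠ ∞ := fun s hs => ne_top_of_le_ne_top one_ne_top <|
    le_of_tendsto (hc s hs) (Eventually.of_forall fun _ => prob_le_one)
  have hsub : content.IsSigmaSubadditive :=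
    isSigmaSubadditive_of_addContent_iUnion_eq_tsum hC fun f hf hU hd =>
      addContent_iUnion_eq_sum_of_tendsto_zero hC content hne_top
        (fun s hs hanti hinter => hc_zero s hs hanti hinter) hf hU hd
  exact ⟨content.measure hC.isSetSemiring hgen.le hsub,
    fun s hs => content.measure_eq hC.isSetSemiring hgen hsub hs⟩

/-- Cylinders over compact sets have the countable finite intersection property. -/
lemma nonempty_iInter_cylinder_of_isCompact {ι : Type*} {X : ι → Type*}
    [∀ i, TopologicalSpace (X i)] [∀ i, T2Space (X i)] {s : ℕ → Finset ι}
    {K : ∀ n, Set (∀ i : s n, X i)} (hK : ∀ n, IsCompact (K n))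
    (hne : ∀ n, (⋂ k ≤ n, cylinder (s k) (K k)).Nonempty) :
    (⋂ n, cylinder (s n) (K n)).Nonempty := by
  classical
  choose x hx using hne
  simp only [mem_iInter, mem_cylinder] at hx
  let V : Ultrafilter ℕ := hyperfilter ℕ
  have hlim : ∀ k, ∃ z ∈ K k, Tendsto (fun n => (s k).restrict (x n)) V (𝓝 z) := fun k =>
    (hK k).ultrafilter_le_nhds' (V.map fun n => (s k).restrict (x n)) <|
      Nat.hyperfilter_le_atTop ((eventually_ge_atTop k).mono fun n hn => hx n k hn)
  let y : ∀ i, X i := fun i =>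
    if h : ∃ a, Tendsto (fun n => x n i) V (𝓝 a) then h.choose else x 0 i
  refine ⟨y, mem_iInter.2 fun k => ?_⟩
  obtain ⟨z, hz, hxz⟩ := hlim k
  have hyz : (s k).restrict y = z := by
    ext i
    have hi : Tendsto (fun n => x n i) V (𝓝 (z i)) := tendsto_pi_nhds.1 hxz i
    have hex : ∃ a, Tendsto (fun n => x n i) V (𝓝 a) := ⟨z i, hi⟩
    simp only [Finset.restrict, y, dif_pos hex]
    exact tendsto_nhds_unique hex.choose_spec hi
  rwa [mem_cylinder, hyz]

/-- A pointwise limit of measures on a product of Polish spaces whose finite-dimensional marginals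
are finite measures is continuous at `∅` along measurable cylinders. -/
lemma tendsto_zero_of_antitone_measurableCylinders {ι β : Type*} {X : ι → Type*}
    [∀ i, TopologicalSpace (X i)] [∀ i, PolishSpace (X i)]
    [∀ i, MeasurableSpace (X i)] [∀ i, BorelSpace (X i)]
    {l : Filter β} [l.NeBot] {μs : β → Measure (∀ i, X i)} {c : Set (∀ i, X i) → ℝ≥0∞}
    (hc : ∀ s, Tendsto (fun m => μs m s) l (𝓝 (c s)))
    {P : ∀ J : Finset ι, Measure (∀ i : J, X i)} [∀ J, IsFiniteMeasure (P J)]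
    (hP : ∀ J S, MeasurableSet S → P J S = c (cylinder J S))
    {A : ℕ → Set (∀ i, X i)} (hA : ∀ n, A n ∈ measurableCylinders X) (hanti : Antitone A)
    (hinter : ⋂ n, A n = ∅) :
    Tendsto (fun n => c (A n)) atTop (𝓝 0) := by
  have hmono : ∀ {s t}, s ⊆ t → c s ≤ c t := fun hst =>
    le_of_tendsto_of_tendsto' (hc _) (hc _) fun _ => measure_mono hst
  have hAn : ∀ n, ∃ J S, MeasurableSet S ∧ A n = cylinder J S :=
    fun n => (mem_measurableCylinders _).1 (hA n)
  choose J S hS hAS using hAn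
  suffices h : ∀ ε, 0 < ε → ∃ n, c (A n) < ε by
    refine tendsto_order.2 ⟨fun a ha => absurd ha (by simp), fun ε hε => ?_⟩
    obtain ⟨n, hn⟩ := h ε hε
    exact (eventually_ge_atTop n).mono fun k hk => (hmono (hanti hk)).trans_lt hn
  intro ε hε
  obtain ⟨δ, hδ, hδε⟩ := ENNReal.exists_pos_sum_of_countable' hε.ne' ℕ
  have hcompact : ∀ n, ∃ K ⊆ S n, IsCompact K ∧ P (J n) (S n \ K) < δ n := fun n =>
    (hS n).exists_isCompact_sdiff_lt (measure_ne_top _ _) (hδ n).ne'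
  choose K hKS hK hKδ using hcompact
  have hKinter : ¬ (⋂ n, cylinder (J n) (K n)).Nonempty := by
    rw [not_nonempty_iff_eq_empty, ← subset_empty_iff, ← hinter]
    refine iInter_mono fun n => ?_
    rw [hAS]
    exact preimage_mono (hKS n)
  obtain ⟨n, hn⟩ : ∃ n, ¬ (⋂ k ≤ n, cylinder (J k) (K k)).Nonempty := by
    by_contra! h
    exact hKinter (nonempty_iInter_cylinder_of_isCompact hK h)
  refine ⟨n, lt_of_le_of_lt ?_ hδε⟩
  have hcover : A n ⊆ ⋃ k ∈ Finset.range (n + 1), cylinder (J k) (S k \ K k) := by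
    intro x hx
    by_contra hxn
    refine hn ⟨x, mem_iInter₂.2 fun k hk => ?_⟩
    by_contra hxk
    have hxS : x ∈ cylinder (J k) (S k) := hAS k ▸ hanti hk hx
    exact hxn (mem_iUnion₂.2 ⟨k, Finset.mem_range_succ_iff.2 hk, hxS, hxk⟩)
  calc c (A n) ≤ ∑ k ∈ Finset.range (n + 1), c (cylinder (J k) (S k \ K k)) :=
        le_of_tendsto_of_tendsto' (hc _) (tendsto_finsetSum _ fun k _ => hc _) fun m =>
          (measure_mono hcover).trans (measure_biUnion_finset_le _ _)
    _ ≤ ∑ k ∈ Finset.range (n + 1), δ k := Finset.sum_le_sum fun k _ => by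
        rw [← hP _ _ ((hS k).diff (hK k).measurableSet)]
        exact (hKδ k).le
    _ ≤ ∑' k, δ k := ENNReal.sum_le_tsum _

lemma localSigmaAlgebra_eq_comap_restrict {I : Type*} (E : I → Type*)
    [∀ i, MeasurableSpace (E i)] (Λ : Finset I) :
    localSigmaAlgebra E Λ = MeasurableSpace.comap Λ.restrict MeasurableSpace.pi := by
  simp only [localSigmaAlgebra, MeasurableSpace.pi, MeasurableSpace.comap_iSup,
    MeasurableSpace.comap_comp, iSup_subtype]
  rfl

lemma measurableSet_localSigmaAlgebra_iff {I : Type*} {E : I → Type*}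
    [∀ i, MeasurableSpace (E i)] {Λ : Finset I} {B : Set (∀ i, E i)} :
    MeasurableSet[localSigmaAlgebra E Λ] B ↔ ∃ S, MeasurableSet S ∧ cylinder Λ S = B := by
  rw [localSigmaAlgebra_eq_comap_restrict]
  rfl

theorem lec_family_has_cluster_point {I : Type*} [Countable I] (E : I → Type*)
    [∀ i, TopologicalSpace (E i)] [∀ i, PolishSpace (E i)]
    [∀ i, MeasurableSpace (E i)] [∀ i, BorelSpace (E i)]
    (μs : ℕ → Measure (∀ i, E i)) (hprob : ∀ m, IsProbabilityMeasure (μs m))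
    (hLEC : ∀ (Λ : Finset I) (B : ℕ → Set (∀ i, E i)),
      (∀ n, MeasurableSet[localSigmaAlgebra E Λ] (B n)) → Antitone B →
      (⋂ n, B n) = ∅ →
      Tendsto (fun n => limsup (fun m => μs m (B n)) atTop) atTop (nhds 0)) :
    ∃ μ : Measure (∀ i, E i), IsProbabilityMeasure μ ∧
      ∀ ε : ℝ, 0 < ε → ∀ (N : ℕ) (B : Fin N → Set (∀ i, E i)),
        (∀ j, ∃ Λ : Finset I, MeasurableSet[localSigmaAlgebra E Λ] (B j)) →
        {m : ℕ | ∀ j, |(μs m (B j)).toReal - (μ (B j)).toReal| < ε}.Infinite := by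
  let U : Ultrafilter ℕ := hyperfilter ℕ
  have hlim : ∀ s, ∃ a, Tendsto (fun m => μs m s) U (𝓝 a) := fun s =>
    ⟨_, (U.map fun m => μs m s).le_nhds_lim⟩
  choose c hc using hlim
  have hc_le : ∀ s, c s ≤ limsup (fun m => μs m s) atTop := fun s =>
    (hc s).limsup_eq ▸ limsup_le_limsup_of_le Nat.hyperfilter_le_atTop
  have hmarginal : ∀ Λ : Finset I, ∃ P : Measure (∀ i : Λ, E i),
      ∀ S, MeasurableSet S → P S = c (cylinder Λ S) := fun Λ =>
    exists_measure_eq_of_tendsto (C := {S | MeasurableSet S}) (l := U) (μs := fun m => (μs m).map Λ.restrict)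
      ⟨MeasurableSet.empty, fun _ _ hs ht => hs.union ht, fun _ _ hs ht => hs.diff ht⟩
      MeasurableSpace.generateFrom_measurableSet.symm
      (fun m => Measure.isProbabilityMeasure_map (Finset.measurable_restrict Λ).aemeasurable)
      (fun S hS => by
        simpa only [Measure.map_apply (Finset.measurable_restrict Λ) hS, cylinder] using hc (cylinder Λ S))
      (fun S hS hanti hinter => tendsto_of_tendsto_of_tendsto_of_le_of_le tendsto_const_nhds
        (hLEC Λ (fun n => cylinder Λ (S n))
          (fun n => measurableSet_localSigmaAlgebra_iff.2 ⟨S n, hS n, rfl⟩)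
          (fun _ _ hmn => preimage_mono (hanti hmn))
          (by simp only [cylinder, ← preimage_iInter, hinter, preimage_empty]))
        (fun _ => zero_le) (fun _ => hc_le _))
  choose P hP using hmarginal
  have hc_univ : c univ = 1 := tendsto_nhds_unique (hc univ) (by simp)
  have hP_finite : ∀ Λ, IsFiniteMeasure (P Λ) := fun Λ =>
    ⟨by rw [hP Λ univ .univ, cylinder_univ, hc_univ]; exact ENNReal.one_lt_top⟩
  obtain ⟨μ, hμ⟩ := exists_measure_eq_of_tendsto isSetRing_measurableCylinders
    generateFrom_measurableCylinders.symm hprob (fun s _ => hc s)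
    (fun A hA hanti hinter =>
      tendsto_zero_of_antitone_measurableCylinders hc hP hA hanti hinter)
  have hμ_prob : IsProbabilityMeasure μ :=
    ⟨by rw [hμ _ (univ_mem_measurableCylinders E), hc_univ]⟩
  refine ⟨μ, hμ_prob, fun ε hε N B hB hfin => hfin.notMem_hyperfilter ?_⟩
  refine eventually_all.2 fun j => ?_
  obtain ⟨Λ, hΛ⟩ := hB j
  obtain ⟨S, hS, hSB⟩ := measurableSet_localSigmaAlgebra_iff.1 hΛ
  have hBj : μ (B j) = c (B j) := hμ _ (hSB ▸ cylinder_mem_measurableCylinders Λ S hS)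
  have htend : Tendsto (fun m => (μs m (B j)).toReal) U (𝓝 (μ (B j)).toReal) :=
    (ENNReal.tendsto_toReal (measure_ne_top _ _)).comp (hBj ▸ hc (B j))
  simpa only [Real.dist_eq] using Metric.tendsto_nhds.1 htend ε hε
end

section
/- Let m ∈ ℕ, β > 0, M ≥ 0, 𝒥 ≥ 0, C_W ≥ 0, r > 0 and L ≥ 1. Let γ and η be finite sets with N(η) ≤ L, let σ : γ → ℝ^m and ξ : η → ℝ^m be mark assignments with Σ_{y∈η} |ξ_y|^r ≤ L, let Φ : γ × η → ℝ satisfy Φ(x,y) ≥ −M, and let w : γ × η → ℝ satisfy |w(x,y)| ≤ 𝒥·(|σ_x|^r + |ξ_y|^r + C_W) for all x ∈ γ, y ∈ η. Then | 1 − exp( −β · Σ_{x∈γ} Σ_{y∈η} (Φ(x,y) + w(x,y)) ) | ≤ exp( β·[ M·L·N(γ) + 𝒥·L·Σ_{x∈γ} |σ_x|^r + 𝒥·L·(L + C_W)·N(γ) ] ) − 1 + L·N(γ). -/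
/-- A lower bound for the total interaction of `γ` with `η`, in terms of `a`, `b` bounding the
growth of `w` and a bound `L` on both the cardinality of `η` and the total weight of `b`. -/
theorem neg_sum_sum_add_le {α β : Type*} {M J C L : ℝ} (hM : 0 ≤ M) (hJ : 0 ≤ J) (hC : 0 ≤ C)
    {γ : Finset α} {η : Finset β} (hcard : (η.card : ℝ) ≤ L)
    {a : α → ℝ} {b : β → ℝ} (ha : ∀ x ∈ γ, 0 ≤ a x) (hb : ∑ y ∈ η, b y ≤ L)
    {Φ w : α → β → ℝ} (hΦ : ∀ x ∈ γ, ∀ y ∈ η, -M ≤ Φ x y)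
    (hw : ∀ x ∈ γ, ∀ y ∈ η, |w x y| ≤ J * (a x + b y + C)) :
    -∑ x ∈ γ, ∑ y ∈ η, (Φ x y + w x y) ≤
      M * L * (γ.card : ℝ) + J * L * ∑ x ∈ γ, a x + J * L * (1 + C) * (γ.card : ℝ) := by
  have hrow : ∀ x ∈ γ, -∑ y ∈ η, (Φ x y + w x y) ≤ M * L + J * L * a x + J * L * (1 + C) := by
    intro x hx
    calc -∑ y ∈ η, (Φ x y + w x y)
        = ∑ y ∈ η, -(Φ x y + w x y) := by rw [Finset.sum_neg_distrib]
      _ ≤ ∑ y ∈ η, ((M + J * (a x + C)) + J * b y) := by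
          refine Finset.sum_le_sum fun y hy => ?_
          linarith [hΦ x hx y hy, neg_le_of_abs_le (hw x hx y hy)]
      _ = (M + J * (a x + C)) * η.card + J * ∑ y ∈ η, b y := by
          rw [Finset.sum_add_distrib, Finset.sum_const, nsmul_eq_mul, ← Finset.mul_sum]
          ring
      _ ≤ (M + J * (a x + C)) * L + J * L := by
          have := ha x hx
          gcongr
      _ = M * L + J * L * a x + J * L * (1 + C) := by ring
  calc -∑ x ∈ γ, ∑ y ∈ η, (Φ x y + w x y)
      = ∑ x ∈ γ, -∑ y ∈ η, (Φ x y + w x y) := by rw [Finset.sum_neg_distrib]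
    _ ≤ ∑ x ∈ γ, (M * L + J * L * a x + J * L * (1 + C)) := Finset.sum_le_sum hrow
    _ = _ := by
        rw [Finset.sum_add_distrib, Finset.sum_add_distrib, Finset.sum_const, Finset.sum_const,
          nsmul_eq_mul, nsmul_eq_mul, ← Finset.mul_sum]
        ring


theorem dobrushin_factor_estimate {α β : Type*}
    (m : ℕ) (β' M 𝒥 CW r L : ℝ)
    (hβ : 0 < β') (hM : 0 ≤ M) (h𝒥 : 0 ≤ 𝒥) (hCW : 0 ≤ CW) (hr : 0 < r)
    (hL : 1 ≤ L)
    (γ : Finset α) (η : Finset β)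
    (hηcard : (η.card : ℝ) ≤ L)
    (σ : α → EuclideanSpace ℝ (Fin m)) (ξ : β → EuclideanSpace ℝ (Fin m))
    (hξ : ∑ y ∈ η, ‖ξ y‖ ^ r ≤ L)
    (Φ : α → β → ℝ) (hΦ : ∀ x ∈ γ, ∀ y ∈ η, -M ≤ Φ x y)
    (w : α → β → ℝ)
    (hw : ∀ x ∈ γ, ∀ y ∈ η, |w x y| ≤ 𝒥 * (‖σ x‖ ^ r + ‖ξ y‖ ^ r + CW)) :
    |1 - Real.exp (-β' * ∑ x ∈ γ, ∑ y ∈ η, (Φ x y + w x y))| ≤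
      Real.exp (β' * (M * L * (γ.card : ℝ)
          + 𝒥 * L * ∑ x ∈ γ, ‖σ x‖ ^ r
          + 𝒥 * L * (L + CW) * (γ.card : ℝ)))
        - 1 + L * (γ.card : ℝ) := by
  rcases γ.eq_empty_or_nonempty with rfl | hγ
  · simp
  have hN : (1 : ℝ) ≤ γ.card := by exact_mod_cast hγ.card_pos
  have ha : ∀ x ∈ γ, 0 ≤ ‖σ x‖ ^ r := fun x _ => by positivity
  have hsum := Finset.sum_nonneg ha
  have hLN : 1 ≤ L * (γ.card : ℝ) := one_le_mul_of_one_le_of_one_le hL hN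
  set B : ℝ := M * L * (γ.card : ℝ) + 𝒥 * L * ∑ x ∈ γ, ‖σ x‖ ^ r
    + 𝒥 * L * (L + CW) * (γ.card : ℝ) with hB
  have hS : -∑ x ∈ γ, ∑ y ∈ η, (Φ x y + w x y) ≤ B := by
    refine (neg_sum_sum_add_le hM h𝒥 hCW hηcard ha hξ hΦ hw).trans ?_
    rw [hB]
    gcongr
  have hB0 : 0 ≤ B := by positivity
  have hupper : Real.exp (-β' * ∑ x ∈ γ, ∑ y ∈ η, (Φ x y + w x y)) ≤ Real.exp (β' * B) := by
    rw [neg_mul_comm]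
    gcongr
  have hone : 1 ≤ Real.exp (β' * B) := Real.one_le_exp (by positivity)
  have hpos := Real.exp_pos (-β' * ∑ x ∈ γ, ∑ y ∈ η, (Φ x y + w x y))
  rw [abs_le]
  constructor <;> linarith
end
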